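/- arXiv:1809.03417 — 2 statements merged into one kernel-verified Lean document; each statement's English description precedes it below -/
import Mathlib

section
/- Let Γ be a Neumaier graph with parameters (v, k, λ; m, s) such that for every vertex u of Γ, the neighbourhood of u is the disjoint union of l cliques, each of size s − 1. Then Γ is strongly regular with parameters v = s + (l − 1)(s − 1)s/m, k = l(s − 1), λ = (m − 1)(l − 1) + s − 2 and μ = l·m. -/
/-- `G` is edge-regular with parameters `(v, k, lam)`: it has `v` vertices, at least one
edge, is `k`-regular, and every pair of adjacent vertices has exactly `lam` common
neighbours. -/
def IsEdgeRegular {V : Type*} [Fintype V] (G : SimpleGraph V) (v k lam : ℕ) : Prop :=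
  Fintype.card V = v ∧ G ≠ ⊥ ∧ (∀ u : V, (G.neighborSet u).ncard = k) ∧
    ∀ u w : V, G.Adj u w → (G.commonNeighbors u w).ncard = lam

/-- `G` is strongly regular with parameters `(v, k, lam, mu)`: it has `v` vertices, is
neither empty nor complete, is `k`-regular, every pair of adjacent vertices has exactly
`lam` common neighbours and every pair of distinct non-adjacent vertices has exactly
`mu` common neighbours. -/
def IsStronglyRegular {V : Type*} [Fintype V] (G : SimpleGraph V) (v k lam mu : ℕ) : Prop :=
  Fintype.card V = v ∧ G ≠ ⊥ ∧ G ≠ ⊤ ∧ (∀ u : V, (G.neighborSet u).ncard = k) ∧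
    (∀ u w : V, G.Adj u w → (G.commonNeighbors u w).ncard = lam) ∧
    ∀ u w : V, u ≠ w → ¬ G.Adj u w → (G.commonNeighbors u w).ncard = mu

/-- The clique `S` in `G` is `m`-regular (with `m > 0`): every vertex of `G` not in `S`
is adjacent to exactly `m` vertices of `S`. -/
def IsRegularClique {V : Type*} (G : SimpleGraph V) (S : Finset V) (m : ℕ) : Prop :=
  0 < m ∧ ∀ u : V, u ∉ S → (G.neighborSet u ∩ ↑S).ncard = m

/-- `G` is a Neumaier graph with parameters `(v, k, lam; m, s)`: a non-complete
edge-regular graph with parameters `(v, k, lam)` containing an `m`-regular `s`-clique,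
where `s ≥ 2`. -/
def IsNeumaier {V : Type*} [Fintype V] (G : SimpleGraph V) (v k lam m s : ℕ) : Prop :=
  IsEdgeRegular G v k lam ∧ G ≠ ⊤ ∧ 2 ≤ s ∧
    ∃ S : Finset V, G.IsClique ↑S ∧ S.card = s ∧ IsRegularClique G S m

open Classical in
theorem ncard_neighborSet_inter_eq_sum {V : Type*} (G : SimpleGraph V) (S : Finset V) (x : V) :
    ((G.neighborSet x ∩ ↑S).ncard : ℤ) = ∑ c ∈ S, if G.Adj x c then 1 else 0 := by
  have h : G.neighborSet x ∩ ↑S = ↑(S.filter fun c => G.Adj x c) := by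
    ext c
    simp [and_comm]
  rw [h, Set.ncard_coe_finset, Finset.card_filter]
  push_cast
  rfl

open Classical in
/-- The first moment of the number of neighbours in a set of vertices of a regular graph. -/
theorem sum_ncard_neighborSet_inter {V : Type*} [Fintype V] (G : SimpleGraph V) {k : ℕ}
    (hk : ∀ u, (G.neighborSet u).ncard = k) (S : Finset V) :
    ∑ x, ((G.neighborSet x ∩ ↑S).ncard : ℤ) = S.card * k := by
  simp_rw [ncard_neighborSet_inter_eq_sum]
  rw [Finset.sum_comm, ← nsmul_eq_mul, ← Finset.sum_const]
  refine Finset.sum_congr rfl fun c _ => ?_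
  rw [← hk c]
  have h : G.neighborSet c = G.neighborSet c ∩ ↑(Finset.univ : Finset V) := by simp
  rw [h, ncard_neighborSet_inter_eq_sum]
  simp_rw [G.adj_comm c]

open Classical in
/-- The second moment of the number of neighbours in a clique of an edge-regular graph. -/
theorem sum_ncard_neighborSet_inter_sq {V : Type*} [Fintype V] (G : SimpleGraph V) {k lam : ℕ}
    (hk : ∀ u, (G.neighborSet u).ncard = k)
    (hlam : ∀ u w, G.Adj u w → (G.commonNeighbors u w).ncard = lam)
    (S : Finset V) (hS : G.IsClique ↑S) :
    ∑ x, ((G.neighborSet x ∩ ↑S).ncard : ℤ) ^ 2 =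
      S.card * (k + (S.card - 1) * lam) := by
  have key : ∀ c ∈ S, ∀ d ∈ S, (∑ x, (if G.Adj x c then (1 : ℤ) else 0) *
      (if G.Adj x d then 1 else 0)) = lam + if d = c then (k : ℤ) - lam else 0 := by
    intro c hc d hd
    have h : (∑ x, (if G.Adj x c then (1 : ℤ) else 0) * (if G.Adj x d then 1 else 0)) =
        (G.commonNeighbors c d).ncard := by
      have h' : G.commonNeighbors c d =
          ↑(Finset.univ.filter fun x => G.Adj x c ∧ G.Adj x d) := by
        ext x
        simp [SimpleGraph.mem_commonNeighbors, G.adj_comm x]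
      rw [h', Set.ncard_coe_finset, Finset.card_filter]
      push_cast
      refine Finset.sum_congr rfl fun x _ => ?_
      split_ifs <;> simp_all
    rw [h]
    split_ifs with hdc
    · subst hdc
      simp [SimpleGraph.commonNeighbors, hk]
    · rw [hlam c d (hS hc hd (Ne.symm hdc)), add_zero]
  simp_rw [ncard_neighborSet_inter_eq_sum, sq, Finset.sum_mul_sum]
  rw [Finset.sum_comm, Finset.sum_congr rfl fun c hc =>
    (Finset.sum_comm.trans (Finset.sum_congr rfl (key c hc)))]
  rw [Finset.sum_congr rfl fun c (hc : c ∈ S) => by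
    rw [Finset.sum_add_distrib, Finset.sum_ite_eq' S c, if_pos hc]]
  simp only [Finset.sum_const, nsmul_eq_mul]
  ring

theorem ncard_neighborSet_inter_of_mem {V : Type*} (G : SimpleGraph V) {S : Finset V}
    (hS : G.IsClique ↑S) {x : V} (hx : x ∈ S) :
    (G.neighborSet x ∩ ↑S).ncard = S.card - 1 := by
  have h : G.neighborSet x ∩ ↑S = (↑S : Set V) \ {x} := by
    ext y
    simp only [Set.mem_inter_iff, SimpleGraph.mem_neighborSet, Set.mem_sdiff,
      Set.mem_singleton_iff]
    exact ⟨fun h => ⟨h.2, h.1.ne'⟩, fun h => ⟨hS hx h.1 (Ne.symm h.2), h.1⟩⟩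
  rw [h, Set.ncard_sdiff_singleton_of_mem (by simpa using hx), Set.ncard_coe_finset]

/-- Splitting a sum of a function of the number of neighbours in a clique. -/
theorem sum_ncard_neighborSet_inter_split {V : Type*} [Fintype V] [DecidableEq V]
    (G : SimpleGraph V) {S : Finset V} (hS : G.IsClique ↑S) (f : ℕ → ℤ) :
    ∑ x, f (G.neighborSet x ∩ ↑S).ncard =
      S.card * f (S.card - 1) + ∑ x ∈ Sᶜ, f (G.neighborSet x ∩ ↑S).ncard := by
  rw [← Finset.sum_add_sum_compl S, Finset.sum_congr rfl fun x hx => by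
    rw [ncard_neighborSet_inter_of_mem G hS hx], Finset.sum_const, nsmul_eq_mul]

/-- In an edge-regular graph with an `m`-regular clique, all cliques of the same size are
`m`-regular. -/
theorem IsRegularClique.of_card_eq {V : Type*} [Fintype V] {G : SimpleGraph V}
    {v k lam m : ℕ} (hG : IsEdgeRegular G v k lam) {S T : Finset V}
    (hS : G.IsClique ↑S) (hm : IsRegularClique G S m) (hT : G.IsClique ↑T)
    (hST : T.card = S.card) : IsRegularClique G T m := by
  classical
  obtain ⟨-, -, hk, hlam⟩ := hG
  have total : ∀ U : Finset V, G.IsClique ↑U →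
      ∑ x, (((G.neighborSet x ∩ ↑U).ncard : ℤ) - m) ^ 2 =
        U.card * (k + (U.card - 1) * lam) - 2 * m * (U.card * k) + Fintype.card V * m ^ 2 := by
    intro U hU
    rw [← sum_ncard_neighborSet_inter_sq G hk hlam U hU, ← sum_ncard_neighborSet_inter G hk U,
      Finset.mul_sum, ← Finset.sum_sub_distrib, ← Finset.card_univ, ← nsmul_eq_mul,
      ← Finset.sum_const, ← Finset.sum_add_distrib]
    exact Finset.sum_congr rfl fun x _ => by ring
  have split : ∀ U : Finset V, G.IsClique ↑U → _ := fun U hU =>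
    sum_ncard_neighborSet_inter_split G hU fun n => ((n : ℤ) - m) ^ 2
  have hzero : ∑ x ∈ Sᶜ, (((G.neighborSet x ∩ ↑S).ncard : ℤ) - m) ^ 2 = 0 :=
    Finset.sum_eq_zero fun x hx => by rw [hm.2 x (Finset.mem_compl.mp hx)]; ring
  have hTzero : ∑ x ∈ Tᶜ, (((G.neighborSet x ∩ ↑T).ncard : ℤ) - m) ^ 2 = 0 := by
    have h1 := total S hS
    have h2 := total T hT
    have h3 := split S hS
    have h4 := split T hT
    rw [hST] at h2 h4
    linarith
  refine ⟨hm.1, fun x hx => ?_⟩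
  have h := (Finset.sum_eq_zero_iff_of_nonneg fun x _ => sq_nonneg _).mp hTzero x
    (Finset.mem_compl.mpr hx)
  have h' := pow_eq_zero_iff (two_ne_zero) |>.mp h
  omega

/-- Double counting of the edges between a nonempty regular clique and its complement. -/
theorem IsRegularClique.card_mul_eq {V : Type*} [Fintype V] {G : SimpleGraph V} {k m : ℕ}
    (hk : ∀ u, (G.neighborSet u).ncard = k) {S : Finset V} (hS : G.IsClique ↑S)
    (hm : IsRegularClique G S m) (hne : 0 < S.card) :
    (S.card : ℤ) * k =
      S.card * (S.card - 1) + ((Fintype.card V : ℤ) - S.card) * m := by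
  classical
  have h := sum_ncard_neighborSet_inter_split G hS fun n => (n : ℤ)
  rw [sum_ncard_neighborSet_inter G hk, Finset.sum_congr rfl fun x hx => by
    rw [hm.2 x (Finset.mem_compl.mp hx)], Finset.sum_const, nsmul_eq_mul, Finset.card_compl,
    Nat.cast_sub (Finset.card_le_univ S), Nat.cast_sub hne] at h
  simpa using h

theorem ncard_inter_iUnion {V : Type*} [Fintype V] {P : Finset (Finset V)}
    (hP : (↑P : Set (Finset V)).PairwiseDisjoint id) (T : Set V) :
    (T ∩ ⋃ C ∈ P, (↑C : Set V)).ncard = ∑ C ∈ P, (T ∩ ↑C).ncard := by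
  classical
  have h : T ∩ ⋃ C ∈ P, (↑C : Set V) = ↑(P.biUnion fun C => C.filter (· ∈ T)) := by
    ext x
    simp
    tauto
  rw [h, Set.ncard_coe_finset, Finset.card_biUnion]
  · refine Finset.sum_congr rfl fun C _ => ?_
    rw [← Set.ncard_coe_finset]
    congr 1
    ext x
    simp [and_comm]
  · intro C hC D hD hCD
    exact (hP hC hD hCD).mono (Finset.filter_subset _ _) (Finset.filter_subset _ _)

/-- If `Γ` is a Neumaier graph with parameters `(v, k, λ; m, s)` in which the
neighbourhood of every vertex is the disjoint union of `l` cliques of size `s − 1`,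
then `Γ` is strongly regular with parameters `v = s + (l − 1)(s − 1)s/m`,
`k = l(s − 1)`, `λ = (m − 1)(l − 1) + s − 2` and `μ = l·m`. -/
theorem neumaier_local_cliques_srg {V : Type*} [Fintype V] (G : SimpleGraph V)
    (v k lam m s l : ℕ) (h : IsNeumaier G v k lam m s)
    (hnbhd : ∀ u : V, ∃ P : Finset (Finset V), P.card = l ∧
      (∀ C ∈ P, G.IsClique ↑C ∧ C.card = s - 1) ∧
      (↑P : Set (Finset V)).PairwiseDisjoint id ∧
      G.neighborSet u = ⋃ C ∈ P, (↑C : Set V)) :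
    IsStronglyRegular G v k lam (l * m) ∧
      (v : ℚ) = (s : ℚ) + ((l : ℚ) - 1) * ((s : ℚ) - 1) * (s : ℚ) / (m : ℚ) ∧
      (k : ℤ) = (l : ℤ) * ((s : ℤ) - 1) ∧
      (lam : ℤ) = ((m : ℤ) - 1) * ((l : ℤ) - 1) + (s : ℤ) - 2 := by
  classical
  obtain ⟨hG, htop, hs, S, hS, hSs, hm⟩ := h
  obtain ⟨hv, hbot, hk, hlam⟩ := hG
  have hreg : ∀ u : V, ∀ C : Finset V, G.IsClique ↑C → C.card = s - 1 →
      ↑C ⊆ G.neighborSet u → IsRegularClique G (insert u C) m := by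
    intro u C hC hCs hCu
    have huC : u ∉ C := fun hu => G.irrefl (hCu hu)
    refine hm.of_card_eq ⟨hv, hbot, hk, hlam⟩ hS ?_ ?_
    · rw [Finset.coe_insert]
      exact hC.insert fun b hb _ => hCu hb
    · rw [Finset.card_insert_of_notMem huC]
      omega
  obtain ⟨u, w, huw⟩ := SimpleGraph.ne_bot_iff_exists_adj.mp hbot
  obtain ⟨P, hPl, hP, hdisj, hN⟩ := hnbhd u
  have hkl : (k : ℤ) = l * (s - 1) := by
    have h := ncard_inter_iUnion hdisj Set.univ
    rw [← hN, Set.univ_inter, hk u, Finset.sum_congr rfl fun C hC => by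
      rw [Set.univ_inter, Set.ncard_coe_finset, (hP C hC).2], Finset.sum_const, hPl] at h
    rw [h, smul_eq_mul]
    push_cast [Nat.cast_sub (by omega : 1 ≤ s)]
    ring
  refine ⟨⟨hv, hbot, htop, hk, hlam, ?_⟩, ?_, hkl, ?_⟩
  · intro u w huw hadj
    obtain ⟨P, hPl, hP, hdisj, hN⟩ := hnbhd u
    rw [SimpleGraph.commonNeighbors, Set.inter_comm, hN, ncard_inter_iUnion hdisj, ← hPl,
      ← smul_eq_mul, ← Finset.sum_const]
    refine Finset.sum_congr rfl fun C hC => ?_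
    have hCu : ↑C ⊆ G.neighborSet u :=
        hN ▸ Set.subset_biUnion_of_mem (u := fun C : Finset V => (↑C : Set V)) hC
    have hw : w ∉ insert u C := by
      rw [Finset.mem_insert, not_or]
      exact ⟨huw.symm, fun hw => hadj (hCu hw)⟩
    rw [← (hreg u C (hP C hC).1 (hP C hC).2 hCu).2 w hw, Finset.coe_insert,
      Set.inter_insert_of_notMem]
    exact fun h => hadj (G.adj_symm h)
  · have h := hm.card_mul_eq hk hS (by omega)
    rw [hSs, hv, hkl] at h
    have hm0 : (m : ℚ) ≠ 0 := by exact_mod_cast hm.1.ne'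
    have h' : (s : ℚ) * (l * (s - 1)) = s * (s - 1) + (v - s) * m := by exact_mod_cast h
    field_simp
    linarith
  · have hwP : w ∈ ⋃ C ∈ P, (↑C : Set V) := hN ▸ huw
    simp only [Set.mem_iUnion, exists_prop] at hwP
    obtain ⟨D, hD, hwD⟩ := hwP
    have hDcard := ncard_neighborSet_inter_of_mem G (hP D hD).1 hwD
    have hother : ∀ C ∈ P.erase D, (G.neighborSet w ∩ ↑C).ncard = m - 1 := by
      intro C hC
      obtain ⟨hCD, hC⟩ := Finset.mem_erase.mp hC
      have hCu : ↑C ⊆ G.neighborSet u :=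
        hN ▸ Set.subset_biUnion_of_mem (u := fun C : Finset V => (↑C : Set V)) hC
      have huC : u ∉ C := fun hu => G.irrefl (hCu hu)
      have hw : w ∉ insert u C := by
        rw [Finset.mem_insert, not_or]
        exact ⟨huw.ne', fun hw => Finset.disjoint_left.mp (hdisj hC hD hCD) hw hwD⟩
      rw [← (hreg u C (hP C hC).1 (hP C hC).2 hCu).2 w hw, Finset.coe_insert,
        Set.inter_insert_of_mem (show u ∈ G.neighborSet w from huw.symm),
        Set.ncard_insert_of_notMem (fun h => huC h.2), Nat.add_sub_cancel]
    have h := hlam u w huw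
    rw [SimpleGraph.commonNeighbors, Set.inter_comm, hN, ncard_inter_iUnion hdisj,
      ← Finset.add_sum_erase P _ hD, hDcard, (hP D hD).2, Finset.sum_congr rfl hother,
      Finset.sum_const, Finset.card_erase_of_mem hD, hPl, smul_eq_mul] at h
    have hl : 1 ≤ l := hPl ▸ Finset.card_pos.mpr ⟨D, hD⟩
    have hs1 : 1 ≤ s - 1 := by omega
    rw [← h]
    push_cast [Nat.cast_sub hl, Nat.cast_sub hm.1, Nat.cast_sub hs1,
      Nat.cast_sub (by omega : 1 ≤ s)]
    ring
end

section
/- Let Γ be a Neumaier graph with parameters (v, k, λ; m, s) such that k − λ − s + m − 1 = 0 and m ≥ 3. Then Γ is isomorphic to the complete multipartite graph K_{s×2} with s parts of size 2. -/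
open Finset in
/-- First two moments of the number of neighbours in a clique of an edge-regular graph. -/
theorem sum_card_neighborFinset_inter {V : Type*} [Fintype V] [DecidableEq V]
    (G : SimpleGraph V) [DecidableRel G.Adj] {k lam : ℕ}
    (hk : ∀ u, #(G.neighborFinset u) = k)
    (hl : ∀ u w, G.Adj u w → #(G.neighborFinset u ∩ G.neighborFinset w) = lam)
    {C : Finset V} (hC : G.IsClique (C : Set V)) :
    ∑ z, (#(G.neighborFinset z ∩ C) : ℤ) = #C * k ∧
      ∑ z, (#(G.neighborFinset z ∩ C) : ℤ) ^ 2 = #C * k + #C * (#C - 1) * lam := by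
  have hc : ∀ z, (#(G.neighborFinset z ∩ C) : ℤ) = ∑ x ∈ C, if G.Adj x z then 1 else 0 := by
    intro z
    rw [Finset.sum_boole]
    congr 2
    ext x
    simp [G.adj_comm, and_comm]
  have h1 : ∀ x, (∑ z, if G.Adj x z then (1 : ℤ) else 0) = k := by
    intro x
    rw [Finset.sum_boole, ← hk x, G.neighborFinset_eq_filter]
  have h2 : ∀ x ∈ C, ∀ y ∈ C, (∑ z, (if G.Adj x z then (1 : ℤ) else 0) *
      (if G.Adj y z then 1 else 0)) = if x = y then (k : ℤ) else lam := by
    intro x hx y hy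
    split_ifs with hxy
    · subst hxy
      rw [← h1 x]
      refine Finset.sum_congr rfl fun z _ => ?_
      split_ifs <;> simp
    · rw [← hl x y (hC hx hy hxy)]
      simp only [← ite_and, mul_ite, mul_one, mul_zero]
      rw [Finset.sum_boole]
      congr 2
      ext z
      simp [and_comm]
  constructor
  · simp_rw [hc]
    rw [Finset.sum_comm]
    simp [h1]
  · simp_rw [hc, sq, Finset.sum_mul_sum]
    rw [Finset.sum_comm]
    have : ∀ x ∈ C, (∑ z, ∑ y ∈ C, (if G.Adj x z then (1 : ℤ) else 0) *
        (if G.Adj y z then 1 else 0)) = k + (#C - 1) * lam := by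
      intro x hx
      rw [Finset.sum_comm, Finset.sum_congr rfl (h2 x hx), ← Finset.add_sum_erase _ _ hx]
      rw [Finset.sum_congr rfl (g := fun _ => (lam : ℤ))
        (fun y hy => if_neg (Finset.ne_of_mem_erase hy).symm)]
      have := Finset.card_erase_add_one hx
      simp only [if_true, Finset.sum_const, nsmul_eq_mul]
      congr 2
      push_cast [← this]
      ring
    rw [Finset.sum_congr rfl this]
    simp
    ring

open Finset in
theorem neighborFinset_inter_of_isClique {V : Type*} [Fintype V] [DecidableEq V]
    (G : SimpleGraph V) [DecidableRel G.Adj] {C : Finset V} (hC : G.IsClique (C : Set V))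
    {x : V} (hx : x ∈ C) : G.neighborFinset x ∩ C = C.erase x := by
  ext z
  simp only [mem_inter, SimpleGraph.mem_neighborFinset, mem_erase]
  exact ⟨fun h => ⟨h.1.ne', h.2⟩, fun h => ⟨hC hx h.2 h.1.symm, h.2⟩⟩

open Finset in
/-- Moments of the number of neighbours of the vertices outside a clique. -/
theorem sum_compl_card_neighborFinset_inter {V : Type*} [Fintype V] [DecidableEq V]
    (G : SimpleGraph V) [DecidableRel G.Adj] {k lam : ℕ}
    (hk : ∀ u, #(G.neighborFinset u) = k)
    (hl : ∀ u w, G.Adj u w → #(G.neighborFinset u ∩ G.neighborFinset w) = lam)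
    {C : Finset V} (hC : G.IsClique (C : Set V)) :
    ∑ z ∈ Cᶜ, (#(G.neighborFinset z ∩ C) : ℤ) = #C * (k - #C + 1) ∧
      ∑ z ∈ Cᶜ, (#(G.neighborFinset z ∩ C) : ℤ) ^ 2 =
        #C * (k - #C + 1) + #C * (#C - 1) * (lam - #C + 2) := by
  obtain ⟨h1, h2⟩ := sum_card_neighborFinset_inter G hk hl hC
  have hc : ∀ z ∈ C, (#(G.neighborFinset z ∩ C) : ℤ) = #C - 1 := by
    intro z hz
    rw [neighborFinset_inter_of_isClique G hC hz, ← Finset.card_erase_add_one hz]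
    push_cast
    ring
  rw [← Finset.sum_add_sum_compl C, Finset.sum_congr rfl hc] at h1
  rw [← Finset.sum_add_sum_compl C,
    Finset.sum_congr rfl (fun z hz => congrArg (· ^ 2) (hc z hz))] at h2
  simp only [Finset.sum_const, nsmul_eq_mul] at h1 h2
  constructor
  · linarith
  · linarith

open Finset in
/-- In an edge-regular graph, a clique of the same size as an `m`-regular clique is
`m`-regular. -/
theorem card_neighborFinset_inter_of_card_eq {V : Type*} [Fintype V] [DecidableEq V]
    (G : SimpleGraph V) [DecidableRel G.Adj] {k lam m : ℕ}
    (hk : ∀ u, #(G.neighborFinset u) = k)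
    (hl : ∀ u w, G.Adj u w → #(G.neighborFinset u ∩ G.neighborFinset w) = lam)
    {S C : Finset V} (hS : G.IsClique (S : Set V)) (hC : G.IsClique (C : Set V))
    (hSm : ∀ u, u ∉ S → #(G.neighborFinset u ∩ S) = m) (hcard : #C = #S) :
    ∀ u, u ∉ C → #(G.neighborFinset u ∩ C) = m := by
  have key : ∀ D : Finset V, G.IsClique (D : Set V) → #D = #S →
      ∑ z ∈ Dᶜ, ((#(G.neighborFinset z ∩ D) : ℤ) - m) ^ 2 =
        #S * (k - #S + 1) + #S * (#S - 1) * (lam - #S + 2) - 2 * m * (#S * (k - #S + 1)) +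
          (#(univ : Finset V) - #S) * m ^ 2 := by
    intro D hD hDS
    obtain ⟨h1, h2⟩ := sum_compl_card_neighborFinset_inter G hk hl hD
    have h3 := Finset.card_compl_add_card D
    simp only [sub_sq, Finset.sum_add_distrib, Finset.sum_sub_distrib, ← Finset.sum_mul,
      ← Finset.mul_sum, h1, h2, Finset.sum_const, nsmul_eq_mul, Finset.card_univ, ← h3, hDS]
    push_cast
    ring
  have h0 : ∑ z ∈ Cᶜ, ((#(G.neighborFinset z ∩ C) : ℤ) - m) ^ 2 = 0 := by
    rw [key C hC hcard, ← key S hS rfl]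
    refine Finset.sum_eq_zero fun z hz => ?_
    rw [hSm z (Finset.mem_compl.1 hz)]
    simp
  rw [Finset.sum_eq_zero_iff_of_nonneg fun _ _ => sq_nonneg _] at h0
  intro u hu
  have := h0 u (Finset.mem_compl.2 hu)
  rw [sq_eq_zero_iff, sub_eq_zero] at this
  exact_mod_cast this

open Finset in
/-- If `k + m = lam + s + 1`, the neighbours outside an `m`-regular `s`-clique of a vertex of
the clique are pairwise adjacent. -/
theorem isClique_neighborFinset_sdiff {V : Type*} [Fintype V] [DecidableEq V]
    (G : SimpleGraph V) [DecidableRel G.Adj] {k lam m : ℕ}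
    (hk : ∀ u, #(G.neighborFinset u) = k)
    (hl : ∀ u w, G.Adj u w → #(G.neighborFinset u ∩ G.neighborFinset w) = lam)
    {S : Finset V} (hS : G.IsClique (S : Set V))
    (hSm : ∀ u, u ∉ S → #(G.neighborFinset u ∩ S) = m)
    (heq : k + m = lam + #S + 1) {x : V} (hx : x ∈ S) :
    G.IsClique ((G.neighborFinset x \ S : Finset V) : Set V) := by
  intro y hy z hz hyz
  simp only [coe_sdiff, Set.mem_sdiff, mem_coe, SimpleGraph.mem_neighborFinset] at hy hz
  have e1 : (G.neighborFinset x ∩ G.neighborFinset y) ∩ S = (G.neighborFinset y ∩ S).erase x := by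
    rw [inter_right_comm, neighborFinset_inter_of_isClique G hS hx]
    ext w
    simp only [mem_inter, mem_erase]
    tauto
  have hxy : x ∈ G.neighborFinset y ∩ S := by simp [hx, hy.1.symm]
  have c1 := Finset.card_erase_add_one hxy
  rw [hSm y hy.2, ← e1] at c1
  have c2 := Finset.card_inter_add_card_sdiff (G.neighborFinset x ∩ G.neighborFinset y) S
  rw [hl x y hy.1] at c2
  have c3 := Finset.card_inter_add_card_sdiff (G.neighborFinset x) S
  rw [neighborFinset_inter_of_isClique G hS hx, hk x] at c3
  have c4 := Finset.card_erase_add_one hx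
  have hyA : y ∈ G.neighborFinset x \ S := by simp [hy]
  have c5 := Finset.card_erase_add_one hyA
  have hsub : (G.neighborFinset x ∩ G.neighborFinset y) \ S ⊆
      (G.neighborFinset x \ S).erase y := by
    intro w hw
    simp only [mem_sdiff, mem_inter, SimpleGraph.mem_neighborFinset, mem_erase] at hw ⊢
    exact ⟨hw.1.2.ne', hw.1.1, hw.2⟩
  have he := Finset.eq_of_subset_of_card_le hsub (by omega)
  have hzA : z ∈ (G.neighborFinset x \ S).erase y := by simp [hz, hyz.symm]
  rw [← he] at hzA
  simp only [mem_sdiff, mem_inter, SimpleGraph.mem_neighborFinset] at hzA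
  exact hzA.1.2

open Finset in
theorem le_one_of_card_sdiff_eq {V : Type*} [DecidableEq V] {d : ℕ} (U : V → Finset V)
    {A B C : Finset V} (hAB : #(A \ B) = d + 1) (hAC : #(A \ C) = d + 1)
    (hBA : #(B \ A) = d + 1) (hCA : #(C \ A) = d + 1) (hBC : #(B \ C) = d + 1)
    (hCB : #(C \ B) = d + 1)
    (uAB : ∀ w ∈ A \ B, U w ⊆ B \ A) (uAC : ∀ w ∈ A \ C, U w ⊆ C \ A)
    (uBA : ∀ w ∈ B \ A, U w ⊆ A \ B) (uCA : ∀ w ∈ C \ A, U w ⊆ A \ C)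
    (cAB : ∀ w ∈ A \ B, #(U w) = d)
    (cBA : ∀ w ∈ B \ A, #(U w) = d) (hd : 0 < d) : d ≤ 1 := by
  have hz : ∀ z ∈ (A \ B) ∩ (A \ C), d ≤ #((B \ A) ∩ (C \ A)) := by
    intro z hz
    rw [mem_inter] at hz
    rw [← cAB z hz.1]
    exact card_le_card (subset_inter (uAB z hz.1) (uAC z hz.2))
  by_cases hne : ((B \ A) ∩ (C \ A)).Nonempty
  · obtain ⟨w, hw⟩ := hne
    rw [mem_inter] at hw
    have hd1 : d ≤ #((A \ B) ∩ (A \ C)) := by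
      rw [← cBA w hw.1]
      exact card_le_card (subset_inter (uBA w hw.1) (uCA w hw.2))
    obtain ⟨z, hz'⟩ := card_pos.1 (hd.trans_le hd1)
    have hd2 := hz z hz'
    have hsub : B \ C ⊆ ((A \ C) \ (A \ B)) ∪ ((B \ A) \ (C \ A)) := by
      intro t ht
      simp only [mem_union, mem_sdiff] at ht ⊢
      tauto
    have h1 := card_le_card hsub
    have h2 := card_union_le ((A \ C) \ (A \ B)) ((B \ A) \ (C \ A))
    have h3 := card_inter_add_card_sdiff (A \ C) (A \ B)
    have h4 := card_inter_add_card_sdiff (B \ A) (C \ A)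
    rw [inter_comm] at h3
    omega
  · rw [not_nonempty_iff_eq_empty] at hne
    have hno : ∀ z, z ∉ (A \ B) ∩ (A \ C) := by
      intro z h
      have := hz z h
      rw [hne, card_empty] at this
      omega
    have hsub : (A \ B) ∪ (C \ A) ⊆ C \ B := by
      intro t ht
      have h1 := hno t
      have h2 : t ∉ (B \ A) ∩ (C \ A) := by simp [hne]
      simp only [mem_union, mem_sdiff, mem_inter] at ht h1 h2 ⊢
      tauto
    have hdisj : Disjoint (A \ B) (C \ A) := by
      rw [disjoint_left]
      intro t h1 h2
      simp only [mem_sdiff] at h1 h2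
      exact h2.2 h1.1
    have := card_le_card hsub
    rw [card_union_of_disjoint hdisj] at this
    omega

open Finset in
/-- A graph on `2s` vertices in which every vertex has exactly one non-neighbour other than
itself, and which has an `s`-clique, is `K_{s×2}`. -/
theorem nonempty_iso_completeMultipartiteGraph_of_existsUnique {V : Type*} [Fintype V]
    (G : SimpleGraph V) {S : Finset V} {s : ℕ} (hS : G.IsClique (S : Set V)) (hs : #S = s)
    (hV : Fintype.card V = 2 * s) (hu : ∀ u, ∃! w, w ≠ u ∧ ¬ G.Adj u w) :
    Nonempty (G ≃g SimpleGraph.completeMultipartiteGraph (fun _ : Fin s => Fin 2)) := by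
  choose σ hσ huniq using hu
  have hσσ : ∀ u, σ (σ u) = u := fun u =>
    (huniq (σ u) u ⟨(hσ u).1.symm, fun h => (hσ u).2 h.symm⟩).symm
  have hadj : ∀ u w, G.Adj u w ↔ w ≠ u ∧ w ≠ σ u := by
    intro u w
    constructor
    · rintro h
      exact ⟨h.ne', fun e => (hσ u).2 (e ▸ h)⟩
    · rintro ⟨h1, h2⟩
      by_contra h
      exact h2 (huniq u w ⟨h1, h⟩)
  have hσS : ∀ u ∈ S, σ u ∉ S := fun u h h' => (hσ u).2 (hS h h' (hσ u).1.symm)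
  let e : Fin s ≃ S := (finCongr hs.symm).trans S.equivFin.symm
  let f : (Σ _ : Fin s, Fin 2) → V := fun p => if p.2 = 0 then (e p.1 : V) else σ (e p.1)
  have he : ∀ i j, (e i : V) = e j → i = j := fun i j h => e.injective (Subtype.ext h)
  have hmem : ∀ i, (e i : V) ∈ S := fun i => (e i).2
  have hσinj : Function.Injective σ := Function.LeftInverse.injective hσσ
  have hf : Function.Injective f := by
    rintro ⟨i, a⟩ ⟨j, b⟩ h
    have h1 := hmem i
    have h2 := hσS _ (hmem i)
    have h3 := hmem j
    have h4 := hσS _ (hmem j)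
    fin_cases a <;> fin_cases b <;> simp [f] at h
    · rw [h]
    · rw [h] at h1; exact absurd h1 h4
    · rw [h] at h2; exact absurd h3 h2
    · rw [he _ _ (hσinj h)]
  have hbij : Function.Bijective f := by
    rw [Fintype.bijective_iff_injective_and_card]
    refine ⟨hf, ?_⟩
    simp [hV, mul_comm]
  refine ⟨(SimpleGraph.Iso.symm ⟨Equiv.ofBijective f hbij, ?_⟩)⟩
  rintro ⟨i, a⟩ ⟨j, b⟩
  simp only [Equiv.ofBijective_apply, hadj]
  have hfσ : σ (f ⟨i, a⟩) = f ⟨i, 1 - a⟩ := by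
    fin_cases a <;> simp [f, hσσ]
  rw [hfσ, hf.ne_iff, hf.ne_iff]
  simp only [SimpleGraph.completeMultipartiteGraph, SimpleGraph.comap_adj, SimpleGraph.top_adj,
    ne_eq, Sigma.mk.injEq, heq_eq_eq, not_and]
  fin_cases a <;> fin_cases b <;> simp <;> tauto

open Finset in
/-- An `m`-regular clique in a non-complete graph with `k + m = lam + s + 1` has more than `m`
vertices. -/
theorem lt_card_of_isClique_of_ne_top {V : Type*} [Fintype V] [DecidableEq V]
    (G : SimpleGraph V) [DecidableRel G.Adj] {k lam m : ℕ}
    (hk : ∀ u, #(G.neighborFinset u) = k)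
    (hl : ∀ u w, G.Adj u w → #(G.neighborFinset u ∩ G.neighborFinset w) = lam)
    {S : Finset V} (hS : G.IsClique (S : Set V))
    (hSm : ∀ u, u ∉ S → #(G.neighborFinset u ∩ S) = m)
    (heq : k + m = lam + #S + 1) (hne : S.Nonempty) (htop : G ≠ ⊤) : m < #S := by
  by_contra hms
  rw [not_lt] at hms
  have hout : ∀ u, u ∉ S → ∀ x ∈ S, G.Adj x u := by
    intro u hu x hx
    have := Finset.eq_of_subset_of_card_le
      (inter_subset_right : G.neighborFinset u ∩ S ⊆ S) (by rw [hSm u hu]; exact hms)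
    rw [← this] at hx
    simp only [mem_inter, SimpleGraph.mem_neighborFinset] at hx
    exact hx.1.symm
  obtain ⟨x, hx⟩ := hne
  have hcl := isClique_neighborFinset_sdiff G hk hl hS hSm heq hx
  apply htop
  ext u w
  rw [SimpleGraph.top_adj]
  refine ⟨fun h => h.ne, fun huw => ?_⟩
  by_cases hu : u ∈ S
  · by_cases hw : w ∈ S
    · exact hS hu hw huw
    · exact hout w hw u hu
  · by_cases hw : w ∈ S
    · exact (hout u hu w hw).symm
    · exact hcl (by simp [hu, hout u hu x hx]) (by simp [hw, hout w hw x hx]) huw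

open Finset in
/-- If `k + m = lam + s + 1`, a vertex of an `m`-regular `s`-clique with `0 < m < s` has degree
`2(s - 1)`. -/
theorem degree_add_two_eq_two_mul {V : Type*} [Fintype V] [DecidableEq V]
    (G : SimpleGraph V) [DecidableRel G.Adj] {k lam m : ℕ}
    (hk : ∀ u, #(G.neighborFinset u) = k)
    (hl : ∀ u w, G.Adj u w → #(G.neighborFinset u ∩ G.neighborFinset w) = lam)
    {S : Finset V} (hS : G.IsClique (S : Set V))
    (hSm : ∀ u, u ∉ S → #(G.neighborFinset u ∩ S) = m)
    (heq : k + m = lam + #S + 1) (hms : m < #S) :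
    k + 2 = 2 * #S ∧ Fintype.card V * m = #S * (#S - 1 + m) := by
  obtain ⟨h1, h2⟩ := sum_compl_card_neighborFinset_inter G hk hl hS
  rw [Finset.sum_congr rfl (g := fun _ => (m : ℤ))
    (fun z hz => by rw [hSm z (mem_compl.1 hz)])] at h1
  rw [Finset.sum_congr rfl (g := fun _ => (m : ℤ) ^ 2)
    (fun z hz => by rw [hSm z (mem_compl.1 hz)])] at h2
  simp only [Finset.sum_const, nsmul_eq_mul] at h1 h2
  have h3 := Finset.card_compl_add_card S
  have heq' : (lam : ℤ) = k + m - #S - 1 := by omega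
  have hs0 : (#S : ℤ) ≠ 0 := by omega
  have hsm : (#S : ℤ) - m ≠ 0 := by omega
  have h4 : ((#S : ℤ) * (#S - m)) * ((k : ℤ) + 2 - 2 * #S) = 0 := by
    rw [heq'] at h2
    linear_combination m * h1 - h2
  have hk2 : (k : ℤ) + 2 - 2 * #S = 0 := by
    rcases mul_eq_zero.1 h4 with h | h
    · exact absurd h (mul_ne_zero hs0 hsm)
    · exact h
  refine ⟨by omega, ?_⟩
  have h5 : ((#S - 1 : ℕ) : ℤ) = #S - 1 := by omega
  zify
  rw [h5, ← h3]
  push_cast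
  have hk3 : (k : ℤ) = 2 * #S - 2 := by linarith
  rw [hk3] at h1
  linear_combination h1

open Finset in
/-- If `k + m = lam + s + 1`, an `m`-regular `s`-clique with `3 ≤ m < s` has `m = s - 1`. -/
theorem add_one_eq_card_of_three_le {V : Type*} [Fintype V] [DecidableEq V]
    (G : SimpleGraph V) [DecidableRel G.Adj] {k lam m : ℕ}
    (hk : ∀ u, #(G.neighborFinset u) = k)
    (hl : ∀ u w, G.Adj u w → #(G.neighborFinset u ∩ G.neighborFinset w) = lam)
    {S : Finset V} (hS : G.IsClique (S : Set V))
    (hSm : ∀ u, u ∉ S → #(G.neighborFinset u ∩ S) = m)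
    (heq : k + m = lam + #S + 1) (hms : m < #S) (hm : 3 ≤ m) {y : V} (hy : y ∉ S) :
    m + 1 = #S := by
  obtain ⟨hk2, -⟩ := degree_add_two_eq_two_mul G hk hl hS hSm heq hms
  let T : V → Finset V := fun x => insert x (G.neighborFinset x \ S)
  have hTS : ∀ x ∈ S, #(T x) = #S := by
    intro x hx
    have c3 := Finset.card_inter_add_card_sdiff (G.neighborFinset x) S
    rw [neighborFinset_inter_of_isClique G hS hx, hk x] at c3
    have c4 := Finset.card_erase_add_one hx
    simp only [T]
    rw [card_insert_of_notMem (by simp)]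
    omega
  have hTcl : ∀ x ∈ S, G.IsClique (T x : Set V) := by
    intro x hx
    simp only [T]
    rw [coe_insert, SimpleGraph.isClique_insert]
    refine ⟨isClique_neighborFinset_sdiff G hk hl hS hSm heq hx, fun b hb _ => ?_⟩
    simp only [coe_sdiff, Set.mem_sdiff, mem_coe, SimpleGraph.mem_neighborFinset] at hb
    exact hb.1
  have hTloc : ∀ x ∈ S, y ∈ T x → G.IsClique ((G.neighborFinset y \ T x : Finset V) : Set V) := by
    intro x hx hyx
    refine isClique_neighborFinset_sdiff G hk hl (hTcl x hx) ?_ (by rw [hTS x hx]; exact heq) hyx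
    exact card_neighborFinset_inter_of_card_eq G hk hl hS (hTcl x hx) hSm (hTS x hx)
  have hTint : ∀ x ∈ S, ∀ x' ∈ S, x ≠ x' → #(T x \ T x') = #S - m + 1 := by
    intro x hx x' hx' hne
    have e1 : T x ∩ T x' = (G.neighborFinset x ∩ G.neighborFinset x') \ S := by
      ext w
      simp only [T, mem_inter, mem_insert, mem_sdiff]
      constructor
      · rintro ⟨rfl | h1, rfl | h2⟩
        · exact absurd rfl hne
        · exact absurd hx h2.2
        · exact absurd hx' h1.2
        · exact ⟨⟨h1.1, h2.1⟩, h1.2⟩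
      · rintro ⟨⟨h1, h2⟩, h3⟩
        exact ⟨Or.inr ⟨h1, h3⟩, Or.inr ⟨h2, h3⟩⟩
    have e2 : (G.neighborFinset x ∩ G.neighborFinset x') ∩ S = (S.erase x).erase x' := by
      rw [inter_right_comm, neighborFinset_inter_of_isClique G hS hx]
      ext w
      simp only [mem_inter, mem_erase, SimpleGraph.mem_neighborFinset]
      exact ⟨fun h => ⟨h.2.ne', h.1⟩, fun h => ⟨h.2, hS hx' h.2.2 h.1.symm⟩⟩
    have c1 := Finset.card_inter_add_card_sdiff (G.neighborFinset x ∩ G.neighborFinset x') S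
    rw [hl x x' (hS hx hx' hne), e2, ← e1] at c1
    have c2 := Finset.card_erase_add_one hx
    have c3 := Finset.card_erase_add_one (mem_erase.2 ⟨hne.symm, hx'⟩ : x' ∈ S.erase x)
    have c4 := Finset.card_inter_add_card_sdiff (T x) (T x')
    rw [hTS x hx] at c4
    omega
  have hyadj : ∀ x ∈ S, ∀ x' ∈ S, y ∈ T x → y ∈ T x' → ∀ w ∈ T x' \ T x, G.Adj y w := by
    intro x hx x' hx' hyx hyx' w hw
    rw [mem_sdiff] at hw
    exact hTcl x' hx' hyx' hw.1 fun h => hw.2 (h ▸ hyx)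
  let U : V → Finset V := fun w => (G.neighborFinset y \ G.neighborFinset w).erase w
  have hUcard : ∀ w, G.Adj y w → #(U w) = #S - m := by
    intro w hw
    have c1 := Finset.card_inter_add_card_sdiff (G.neighborFinset y) (G.neighborFinset w)
    have c2 := Finset.card_erase_add_one
      (show w ∈ G.neighborFinset y \ G.neighborFinset w by simp [hw])
    rw [hl y w hw, hk y] at c1
    simp only [U]
    omega
  have hU : ∀ x ∈ S, ∀ x' ∈ S, y ∈ T x → y ∈ T x' → ∀ w ∈ T x' \ T x, U w ⊆ T x \ T x' := by
    intro x hx x' hx' hyx hyx' w hw t ht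
    have hyw := hyadj x hx x' hx' hyx hyx' w hw
    simp only [U, mem_erase, mem_sdiff, SimpleGraph.mem_neighborFinset] at ht
    rw [mem_sdiff] at hw
    rw [mem_sdiff]
    constructor
    · by_contra htx
      refine ht.2.2 (hTloc x hx hyx ?_ ?_ ht.1.symm)
      · simp [hw.2, hyw]
      · simp [htx, ht.2.1]
    · intro htx'
      exact ht.2.2 (hTcl x' hx' hw.1 htx' ht.1.symm)
  obtain ⟨a, b, c, ha, hb, hc, hab, hac, hbc⟩ :=
    (two_lt_card_iff (s := G.neighborFinset y ∩ S)).1 (by rw [hSm y hy]; omega)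
  simp only [mem_inter, SimpleGraph.mem_neighborFinset] at ha hb hc
  have hyT : ∀ x, G.Adj y x → y ∈ T x := fun x hx => by simp [T, hx.symm, hy]
  have ya := hyT a ha.1
  have yb := hyT b hb.1
  have yc := hyT c hc.1
  have := le_one_of_card_sdiff_eq U (d := #S - m) (A := T a) (B := T b) (C := T c)
    (hTint a ha.2 b hb.2 hab) (hTint a ha.2 c hc.2 hac) (hTint b hb.2 a ha.2 hab.symm)
    (hTint c hc.2 a ha.2 hac.symm) (hTint b hb.2 c hc.2 hbc) (hTint c hc.2 b hb.2 hbc.symm)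
    (hU b hb.2 a ha.2 yb ya) (hU c hc.2 a ha.2 yc ya)
    (hU a ha.2 b hb.2 ya yb) (hU a ha.2 c hc.2 ya yc)
    (fun w hw => hUcard w (hyadj b hb.2 a ha.2 yb ya w hw))
    (fun w hw => hUcard w (hyadj a ha.2 b hb.2 ya yb w hw)) (by omega)
  omega

/-- If `Γ` is a Neumaier graph with parameters `(v, k, λ; m, s)`,
`k − λ − s + m − 1 = 0` and `m ≥ 3`, then `Γ` is isomorphic to the complete
multipartite graph `K_{s×2}` with `s` parts of size 2. -/
theorem neumaier_equality_m_ge_three {V : Type*} [Fintype V] (G : SimpleGraph V)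
    (v k lam m s : ℕ) (h : IsNeumaier G v k lam m s)
    (heq : (k : ℤ) - lam - s + m - 1 = 0) (hm : 3 ≤ m) :
    Nonempty (G ≃g SimpleGraph.completeMultipartiteGraph (fun _ : Fin s => Fin 2)) := by
  classical
  obtain ⟨⟨-, -, hk, hl⟩, htop, hs, S, hS, hSs, -, hSm⟩ := h
  replace hk : ∀ u, (G.neighborFinset u).card = k := fun u => by
    rw [← hk u, ← Set.ncard_coe_finset, SimpleGraph.coe_neighborFinset]
  replace hl : ∀ u w, G.Adj u w → (G.neighborFinset u ∩ G.neighborFinset w).card = lam :=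
    fun u w huw => by
      rw [← hl u w huw, ← Set.ncard_coe_finset, Finset.coe_inter,
        SimpleGraph.coe_neighborFinset, SimpleGraph.coe_neighborFinset]
      rfl
  replace hSm : ∀ u, u ∉ S → (G.neighborFinset u ∩ S).card = m := fun u hu => by
    rw [← hSm u hu, ← Set.ncard_coe_finset, Finset.coe_inter, SimpleGraph.coe_neighborFinset]
  subst hSs
  have heq' : k + m = lam + S.card + 1 := by omega
  have hne : S.Nonempty := Finset.card_pos.1 (by omega)
  have hms := lt_card_of_isClique_of_ne_top G hk hl hS hSm heq' hne htop
  obtain ⟨hk2, hV⟩ := degree_add_two_eq_two_mul G hk hl hS hSm heq' hms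
  obtain ⟨y, hy⟩ : ∃ y, y ∉ S := by
    by_contra! hall
    apply htop
    ext u w
    exact ⟨fun h => h.ne, fun h => hS (hall u) (hall w) h⟩
  have hm1 := add_one_eq_card_of_three_le G hk hl hS hSm heq' hms hm hy
  have hV2 : Fintype.card V = 2 * S.card := by
    refine Nat.eq_of_mul_eq_mul_right (show 0 < m by omega) ?_
    rw [hV, ← hm1]
    simp only [Nat.add_sub_cancel]
    ring
  refine nonempty_iso_completeMultipartiteGraph_of_existsUnique G hS rfl hV2 fun u => ?_
  have hcard : ((G.neighborFinset u)ᶜ.erase u).card = 1 := by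
    rw [Finset.card_erase_of_mem (by simp), Finset.card_compl, hk u]
    omega
  obtain ⟨w, hw⟩ := Finset.card_eq_one.1 hcard
  have hiff : ∀ t, (t ≠ u ∧ ¬ G.Adj u t) ↔ t = w := fun t => by
    rw [← Finset.mem_singleton, ← hw]
    simp
  exact ⟨w, (hiff w).2 rfl, fun t ht => (hiff t).1 ht⟩
end
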